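/- Let n ∈ ℕ and define F : (−1,1) → ℝ by F(x) = (1/(2π))·∫_{−1}^{1} ln|x−y|·(d/dy)(√(1−y²)·Uₙ(y)) dy, where (d/dy)(√(1−y²)·Uₙ(y)) = −(n+1)·T_{n+1}(y)·(1−y²)^{−1/2} for y ∈ (−1,1). Then F is differentiable on (−1,1) and F'(x) = ((n+1)/2)·Uₙ(x) for every x ∈ (−1,1). (That is, the weighted Laplace hypersingular operator N_{0,ω} = −∂ₓ S_{0,ω} ω∂ₓω satisfies N_{0,ω}Uₙ = ((n+1)/2)·Uₙ.) -/

import Mathlib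

open MeasureTheory Real

/-- The degree-`n` Chebyshev polynomial of the first kind, as a function `ℝ → ℝ`. -/
noncomputable def chebT (n : ℕ) (x : ℝ) : ℝ :=
  (Polynomial.Chebyshev.T ℝ (n : ℤ)).eval x

/-- The degree-`n` Chebyshev polynomial of the second kind, as a function `ℝ → ℝ`. -/
noncomputable def chebU (n : ℕ) (x : ℝ) : ℝ :=
  (Polynomial.Chebyshev.U ℝ (n : ℤ)).eval x

lemma integral_cos_two_mul_zero_pi (m : ℕ) (hm : m ≠ 0) :
    ∫ u in (0 : ℝ)..π, cos (2 * m * u) = 0 := by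
  have h : (2 * m : ℝ) ≠ 0 := by positivity
  rw [intervalIntegral.integral_comp_mul_left _ h, integral_cos]
  have : sin (2 * m * π) = 0 := by exact_mod_cast sin_nat_mul_pi (2 * m)
  simp [this]

open Polynomial.Chebyshev in
lemma integral_chebyshevU_even_comp_cos (m : ℕ) :
    ∫ u in (0 : ℝ)..π, (U ℝ (2 * m : ℤ)).eval (cos u) = π := by
  induction m with
  | zero => simp
  | succ k ih =>
    have h (u : ℝ) : (U ℝ (2 * (k + 1 : ℕ) : ℤ)).eval (cos u) =
        2 * cos (2 * (k + 1 : ℕ) * u) + (U ℝ (2 * k : ℤ)).eval (cos u) := by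
      have h₁ := congrArg (Polynomial.eval (cos u)) (U_eq_two_mul_T_add_U ℝ (2 * k))
      simp only [Polynomial.eval_add, Polynomial.eval_mul, Polynomial.eval_ofNat, T_real_cos] at h₁
      push_cast at h₁ ⊢
      rw [mul_add, mul_add, mul_one, mul_one, h₁]
    simp_rw [h]
    rw [intervalIntegral.integral_add, ih, intervalIntegral.integral_const_mul,
      integral_cos_two_mul_zero_pi _ k.succ_ne_zero]
    · simp
    · exact Continuous.intervalIntegrable (by fun_prop) _ _
    · exact Continuous.intervalIntegrable (by fun_prop) _ _

lemma intervalIntegrable_log_sin_mul {f : ℝ → ℝ} (hf : Continuous f) (a b : ℝ) :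
    IntervalIntegrable (fun u ↦ log (sin u) * f u) volume a b :=
  (intervalIntegrable_log_sin (a := a) (b := b)).mul_continuousOn hf.continuousOn

open Polynomial.Chebyshev in
lemma integral_log_sin_mul_cos_two_mul (m : ℕ) (hm : m ≠ 0) :
    ∫ u in (0 : ℝ)..π, log (sin u) * cos (2 * m * u) = -π / (2 * m) := by
  have hU (u : ℝ) : (U ℝ (2 * m - 1 : ℤ)).eval (cos u) * sin u = sin (2 * m * u) := by
    simp
  have hX (u : ℝ) : cos u * (U ℝ (2 * m - 1 : ℤ)).eval (cos u) =
      (U ℝ (2 * m : ℤ)).eval (cos u) - cos (2 * m * u) := by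
    have h := congrArg (Polynomial.eval (cos u)) (U_eq_X_mul_U_add_T ℝ (2 * m - 1))
    simp only [sub_add_cancel, Polynomial.eval_add, Polynomial.eval_mul, Polynomial.eval_X,
      T_real_cos] at h
    push_cast at h
    linarith
  have hlog := intervalIntegrable_log_sin_mul (f := fun u ↦ cos (2 * m * u)) (by fun_prop) 0 π
  have hpoly : IntervalIntegrable
      (fun u ↦ cos u * (U ℝ (2 * m - 1 : ℤ)).eval (cos u)) volume 0 π :=
    Continuous.intervalIntegrable (by fun_prop) _ _
  have hcot : ∫ u in (0 : ℝ)..π, cos u * (U ℝ (2 * m - 1 : ℤ)).eval (cos u) = π := by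
    simp_rw [hX]
    rw [intervalIntegral.integral_sub, integral_chebyshevU_even_comp_cos,
      integral_cos_two_mul_zero_pi m hm, sub_zero]
    · exact Continuous.intervalIntegrable (by fun_prop) _ _
    · exact Continuous.intervalIntegrable (by fun_prop) _ _
  have key := intervalIntegral.integral_eq_sub_of_hasDerivAt_of_le
    (f := fun u ↦ (sin u * log (sin u)) * (U ℝ (2 * m - 1 : ℤ)).eval (cos u))
    (f' := fun u ↦ cos u * (U ℝ (2 * m - 1 : ℤ)).eval (cos u) +
      2 * m * (log (sin u) * cos (2 * m * u))) pi_pos.le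
    (((continuous_mul_log.comp continuous_sin).mul (by fun_prop)).continuousOn)
    (fun u hu ↦ by
      have hs : sin u ≠ 0 := (sin_pos_of_mem_Ioo hu).ne'
      have hd := ((hasDerivAt_sin u).log hs).mul
        (((hasDerivAt_id u).const_mul (2 * m : ℝ)).sin)
      have he : (fun u ↦ (sin u * log (sin u)) * (U ℝ (2 * m - 1 : ℤ)).eval (cos u)) =
          (fun u ↦ log (sin u)) * (fun u ↦ sin (2 * m * id u)) := by
        ext v
        simp only [Pi.mul_apply, id, ← hU v]
        ring
      rw [he]
      convert! hd using 1
      simp only [id, ← hU u]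
      field_simp)
    (hpoly.add (hlog.const_mul _))
  rw [intervalIntegral.integral_add hpoly (hlog.const_mul _), hcot,
    intervalIntegral.integral_const_mul] at key
  simp only [sin_pi, sin_zero, zero_mul, sub_zero] at key
  field_simp
  linarith

lemma integral_log_sin_mul_sin_two_mul (m : ℕ) :
    ∫ u in (0 : ℝ)..π, log (sin u) * sin (2 * m * u) = 0 := by
  have h := intervalIntegral.integral_comp_sub_left (a := 0) (b := π)
    (fun u ↦ log (sin u) * sin (2 * m * u)) π
  have hs (u : ℝ) : sin (2 * m * (π - u)) = -sin (2 * m * u) := by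
    have := sin_nat_mul_two_pi_sub (2 * m * u) m
    rw [← this]
    ring_nf
  simp only [sin_pi_sub, hs, mul_neg, intervalIntegral.integral_neg, sub_self, sub_zero] at h
  linarith

lemma integral_log_sin_add_mul_cos_two_mul (m : ℕ) (hm : m ≠ 0) (a : ℝ) :
    ∫ u in (-(π / 2))..(π / 2), log (sin (u + a)) * cos (2 * m * u) =
      -π / (2 * m) * cos (2 * m * a) := by
  have hper : Function.Periodic (fun v ↦ log (sin v) * cos (2 * m * (v - a))) π := by
    intro v
    have := cos_add_nat_mul_two_pi (2 * m * (v - a)) m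
    simp only [sin_add_pi, log_neg_eq_log]
    rw [← this]
    ring_nf
  have h := intervalIntegral.integral_comp_add_right (a := -(π / 2)) (b := π / 2)
    (fun v ↦ log (sin v) * cos (2 * m * (v - a))) a
  simp only [add_sub_cancel_right] at h
  rw [h, show π / 2 + a = -(π / 2) + a + π by ring, hper.intervalIntegral_add_eq _ 0, zero_add]
  have he (v : ℝ) : log (sin v) * cos (2 * m * (v - a)) =
      log (sin v) * cos (2 * m * v) * cos (2 * m * a) +
        log (sin v) * sin (2 * m * v) * sin (2 * m * a) := by
    rw [mul_sub, cos_sub]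
    ring
  simp_rw [he]
  rw [intervalIntegral.integral_add, intervalIntegral.integral_mul_const,
    intervalIntegral.integral_mul_const, integral_log_sin_mul_cos_two_mul m hm,
    integral_log_sin_mul_sin_two_mul]
  · ring
  · exact (intervalIntegrable_log_sin_mul (by fun_prop) _ _).mul_const _
  · exact (intervalIntegrable_log_sin_mul (by fun_prop) _ _).mul_const _

lemma intervalIntegrable_log_sin_add_mul_cos (a c p q : ℝ) :
    IntervalIntegrable (fun u ↦ log (sin (u + a)) * cos (c * u)) volume p q := by
  have h := (intervalIntegrable_log_sin_mul (f := fun v ↦ cos (c * (v - a))) (by fun_prop)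
    (p + a) (q + a)).comp_add_right a
  simpa using h

lemma integral_log_abs_cos_sub_cos_mul_cos (m : ℕ) (hm : m ≠ 0) {φ : ℝ}
    (hφ : φ ∈ Set.Ioo 0 π) :
    ∫ θ in (0 : ℝ)..π, log |cos φ - cos θ| * cos (m * θ) = -π / m * cos (m * φ) := by
  have hsub := intervalIntegral.mul_integral_comp_mul_left (a := 0) (b := π / 2)
    (f := fun θ ↦ log |cos φ - cos θ| * cos (m * θ)) 2
  rw [mul_zero, mul_div_cancel₀ π two_ne_zero] at hsub
  have hae : ∀ᵐ u : ℝ, u ≠ φ / 2 := by simp [ae_iff]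
  have hcongr : ∫ u in (0 : ℝ)..(π / 2), log |cos φ - cos (2 * u)| * cos (m * (2 * u)) =
      ∫ u in (0 : ℝ)..(π / 2), (log 2 * cos (2 * m * u) +
        log (sin (u + φ / 2)) * cos (2 * m * u)) +
        log (sin (u + -(φ / 2))) * cos (2 * m * u) := by
    refine intervalIntegral.integral_congr_ae ?_
    filter_upwards [hae] with u hu hmem
    rw [Set.uIoc_of_le (by positivity)] at hmem
    obtain ⟨h₀, h₁⟩ := hφ
    obtain ⟨h₂, h₃⟩ := hmem
    have hs₁ : sin (u + φ / 2) ≠ 0 := (sin_pos_of_pos_of_lt_pi (by linarith) (by linarith)).ne'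
    have hs₂ : sin (u + -(φ / 2)) ≠ 0 := fun h ↦ hu <| by
      have := (sin_eq_zero_iff_of_lt_of_lt (by linarith) (by linarith)).1 h
      linarith
    have hprod : cos φ - cos (2 * u) = 2 * sin (u + φ / 2) * sin (u + -(φ / 2)) := by
      rw [cos_sub_cos, show (φ + 2 * u) / 2 = u + φ / 2 by ring,
        show (φ - 2 * u) / 2 = -(u + -(φ / 2)) by ring, sin_neg]
      ring
    rw [log_abs, hprod, log_mul (by positivity) hs₂, log_mul two_ne_zero hs₁,
      show (m : ℝ) * (2 * u) = 2 * m * u by ring]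
    ring
  have hcos : ∫ u in (0 : ℝ)..(π / 2), cos (2 * m * u) = 0 := by
    rw [intervalIntegral.integral_comp_mul_left _ (by positivity), integral_cos,
      show 2 * m * (π / 2) = m * π by ring]
    simp
  have hrefl : ∫ u in (0 : ℝ)..(π / 2), log (sin (u + -(φ / 2))) * cos (2 * m * u) =
      ∫ u in (-(π / 2))..0, log (sin (u + φ / 2)) * cos (2 * m * u) := by
    have h := intervalIntegral.integral_comp_neg (a := 0) (b := π / 2)
      (fun u ↦ log (sin (u + φ / 2)) * cos (2 * m * u))
    rw [neg_zero] at h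
    rw [← h]
    congr 1 with u
    rw [show -u + φ / 2 = -(u + -(φ / 2)) by ring, sin_neg, log_neg_eq_log, mul_neg, cos_neg]
  have hadj := intervalIntegral.integral_add_adjacent_intervals
    (intervalIntegrable_log_sin_add_mul_cos (φ / 2) (2 * m) (-(π / 2)) 0)
    (intervalIntegrable_log_sin_add_mul_cos (φ / 2) (2 * m) 0 (π / 2))
  rw [integral_log_sin_add_mul_cos_two_mul m hm,
    show 2 * m * (φ / 2) = m * φ by ring] at hadj
  have hlog : IntervalIntegrable (fun u ↦ log 2 * cos (2 * m * u)) volume 0 (π / 2) :=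
    Continuous.intervalIntegrable (by fun_prop) _ _
  rw [intervalIntegral.integral_add
      (hlog.add (intervalIntegrable_log_sin_add_mul_cos _ _ _ _))
      (intervalIntegrable_log_sin_add_mul_cos _ _ _ _),
    intervalIntegral.integral_add hlog (intervalIntegrable_log_sin_add_mul_cos _ _ _ _),
    intervalIntegral.integral_const_mul, hcos, hrefl] at hcongr
  rw [← hsub, hcongr, mul_zero, zero_add, add_comm, hadj]
  field_simp

lemma chebT_cos (n : ℕ) (θ : ℝ) : chebT n (cos θ) = cos (n * θ) := by
  simp [chebT]

lemma hasDerivAt_chebT_succ (n : ℕ) (x : ℝ) :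
    HasDerivAt (chebT (n + 1)) ((n + 1) * chebU n x) x := by
  have h := (Polynomial.Chebyshev.T ℝ ((n + 1 : ℕ) : ℤ)).hasDerivAt x
  rw [Polynomial.Chebyshev.T_derivative_eq_U] at h
  simpa [chebU] using! h

lemma integral_log_abs_sub_mul_chebT (m : ℕ) (hm : m ≠ 0) {x : ℝ} (hx : x ∈ Set.Ioo (-1) 1) :
    ∫ y in Set.Ioo (-1 : ℝ) 1, log |x - y| * (chebT m y * (√(1 - y ^ 2))⁻¹) =
      -π / m * chebT m x := by
  have hφ : arccos x ∈ Set.Ioo 0 π :=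
    ⟨arccos_pos.2 hx.2, (arccos_le_pi x).lt_of_ne fun h ↦ hx.1.not_ge (arccos_eq_pi.1 h)⟩
  have hcos : cos (arccos x) = x := cos_arccos hx.1.le hx.2.le
  have h := (Polynomial.Chebyshev.integral_measureT fun y ↦ log |x - y| * chebT m y).symm.trans
    Polynomial.Chebyshev.integral_measureT_eq_integral_cos
  rw [intervalIntegral.integral_of_le (by norm_num), integral_Ioc_eq_integral_Ioo] at h
  have hmain := integral_log_abs_cos_sub_cos_mul_cos m hm hφ
  rw [← chebT_cos m (arccos x), hcos] at hmain
  simp only [chebT_cos] at h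
  simpa only [sqrt_inv, mul_assoc] using h.trans hmain

/-- The weighted Laplace hypersingular operator satisfies `N_{0,ω} Uₙ = ((n+1)/2) Uₙ`:
the function `F(x) = (1/(2π)) ∫ ln|x-y| · (d/dy)(√(1-y²)Uₙ(y)) dy`, where
`(d/dy)(√(1-y²)Uₙ(y)) = -(n+1) T_{n+1}(y)/√(1-y²)`, has derivative `((n+1)/2)·Uₙ`. -/
theorem stmt13 (n : ℕ)
    (F : ℝ → ℝ)
    (hF : ∀ x ∈ Set.Ioo (-1 : ℝ) 1,
      F x = (1 / (2 * π)) * ∫ y in Set.Ioo (-1 : ℝ) 1,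
        Real.log |x - y| * (-((n : ℝ) + 1) * chebT (n + 1) y * (Real.sqrt (1 - y ^ 2))⁻¹)) :
    ∀ x ∈ Set.Ioo (-1 : ℝ) 1, HasDerivAt F (((n : ℝ) + 1) / 2 * chebU n x) x := by
  intro x hx
  have hFx : ∀ z ∈ Set.Ioo (-1 : ℝ) 1, F z = chebT (n + 1) z / 2 := by
    intro z hz
    have h (y : ℝ) : log |z - y| * (-((n : ℝ) + 1) * chebT (n + 1) y * (√(1 - y ^ 2))⁻¹) =
        -((n : ℝ) + 1) * (log |z - y| * (chebT (n + 1) y * (√(1 - y ^ 2))⁻¹)) := by ring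
    rw [hF z hz]
    simp_rw [h]
    rw [integral_const_mul, integral_log_abs_sub_mul_chebT (n + 1) n.succ_ne_zero hz]
    push_cast
    field_simp
  have hev : F =ᶠ[nhds x] fun z ↦ chebT (n + 1) z / 2 :=
    Filter.eventually_of_mem (isOpen_Ioo.mem_nhds hx) hFx
  refine HasDerivAt.congr_of_eventuallyEq ?_ hev
  rw [div_mul_eq_mul_div]
  exact (hasDerivAt_chebT_succ n x).div_const 2
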